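/- For every string T and every integer k ≥ 1, the maximum, over all factorizations T = F_1 F_2 ⋯ F_k of T into k (possibly empty) factors, of k times the length of a longest common subsequence of F_1, …, F_k, equals the length of a longest subsequence of T that is of the form V^k (the k-fold concatenation of a string V with itself). -/

import Mathlib

/-- Length of a longest common subsequence of a family of lists
(lists model strings; `List.Sublist` models subsequences). -/
noncomputable def lcsList {α : Type*} (Fs : List (List α)) : ℕ :=
  sSup {n : ℕ | ∃ U : List α, (∀ F ∈ Fs, U.Sublist F) ∧ n = U.length}

theorem exists_forall_sublist_length_eq_lcsList {α : Type*} {Fs : List (List α)} (h : Fs ≠ []) :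
    ∃ U : List α, (∀ F ∈ Fs, U.Sublist F) ∧ lcsList Fs = U.length := by
  refine Nat.sSup_mem (s := {n | ∃ U : List α, (∀ F ∈ Fs, U.Sublist F) ∧ n = U.length})
    ⟨0, [], by simp⟩ ⟨(Fs.head h).length, ?_⟩
  rintro _ ⟨U, hU, rfl⟩
  exact (hU _ (List.head_mem h)).length_le

theorem length_le_lcsList {α : Type*} {Fs : List (List α)} (h : Fs ≠ []) {U : List α}
    (hU : ∀ F ∈ Fs, U.Sublist F) : U.length ≤ lcsList Fs := by
  refine le_csSup ⟨(Fs.head h).length, ?_⟩ ⟨U, hU, rfl⟩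
  rintro _ ⟨W, hW, rfl⟩
  exact (hW _ (List.head_mem h)).length_le

theorem flatten_replicate_sublist_flatten {α : Type*} {U : List α} {Fs : List (List α)}
    (hU : ∀ F ∈ Fs, U.Sublist F) :
    ((List.replicate Fs.length U).flatten).Sublist Fs.flatten := by
  induction Fs with
  | nil => simp
  | cons F Fs ih =>
    rw [List.length_cons, List.replicate_succ, List.flatten_cons, List.flatten_cons]
    exact (hU F (by simp)).append (ih fun G hG => hU G (by simp [hG]))

theorem exists_factorization_of_flatten_replicate_sublist {α : Type*} {V : List α} {k : ℕ}
    (hk : 1 ≤ k) {T : List α} (h : ((List.replicate k V).flatten).Sublist T) :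
    ∃ Fs : List (List α), Fs.length = k ∧ Fs.flatten = T ∧ ∀ F ∈ Fs, V.Sublist F := by
  induction k, hk using Nat.le_induction generalizing T with
  | base => exact ⟨[T], by simp, by simp, by simpa using h⟩
  | succ k _ ih =>
    rw [List.replicate_succ, List.flatten_cons, List.append_sublist_iff] at h
    obtain ⟨F, R, rfl, hF, hR⟩ := h
    obtain ⟨Fs, rfl, rfl, hFs⟩ := ih hR
    exact ⟨F :: Fs, by simp, by simp, by simpa using ⟨hF, hFs⟩⟩

/-- For every string `T` and every `k ≥ 1`, the maximum over all factorizations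
`T = F₁F₂⋯F_k` into `k` (possibly empty) factors of `k · LCS(F₁, …, F_k)` equals the
length of a longest subsequence of `T` of the form `V^k`. -/
theorem longest_k_power_subsequence {α : Type*} [DecidableEq α] (T : List α)
    (k : ℕ) (hk : 1 ≤ k) :
    sSup {n : ℕ | ∃ Fs : List (List α), Fs.length = k ∧ Fs.flatten = T ∧
      n = k * lcsList Fs} =
    sSup {n : ℕ | ∃ V : List α, ((List.replicate k V).flatten).Sublist T ∧
      n = ((List.replicate k V).flatten).length} := by
  have power_of_factorization : ∀ Fs : List (List α), Fs.length = k → Fs.flatten = T →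
      ∃ V : List α, ((List.replicate k V).flatten).Sublist T ∧
        k * lcsList Fs = ((List.replicate k V).flatten).length := by
    rintro Fs rfl rfl
    obtain ⟨U, hU, hlen⟩ :=
      exists_forall_sublist_length_eq_lcsList (List.ne_nil_of_length_pos hk)
    exact ⟨U, flatten_replicate_sublist_flatten hU, by simp [hlen]⟩
  apply le_antisymm
  · refine csSup_le' ?_
    rintro _ ⟨Fs, hlen, hT, rfl⟩
    refine le_csSup ⟨T.length, ?_⟩ (power_of_factorization Fs hlen hT)
    rintro _ ⟨V, hV, rfl⟩
    exact hV.length_le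
  · refine csSup_le' ?_
    rintro _ ⟨V, hV, rfl⟩
    obtain ⟨Fs, hlen, hT, hFs⟩ := exists_factorization_of_flatten_replicate_sublist hk hV
    calc ((List.replicate k V).flatten).length = k * V.length := by simp
      _ ≤ k * lcsList Fs :=
        Nat.mul_le_mul_left k (length_le_lcsList (List.ne_nil_of_length_pos (hlen ▸ hk)) hFs)
      _ ≤ _ := by
        refine le_csSup ⟨T.length, ?_⟩ ⟨Fs, hlen, hT, rfl⟩
        rintro _ ⟨Gs, hGlen, hGT, rfl⟩
        obtain ⟨W, hW, hWlen⟩ := power_of_factorization Gs hGlen hGT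
        exact hWlen ▸ hW.length_le
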